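/- arXiv:1409.7321 — 2 statements merged into one kernel-verified Lean document; each statement's English description precedes it below -/
import Mathlib

section
/- Let k ≥ 1 be an integer and let c : ℝ^k → ℝ be a continuous ℤ^k-periodic function with inf c > 0. If v : ℝ^k → ℝ is a C², ℤ^k-periodic function satisfying −Δv(x) + c(x) v(x) = 0 for all x ∈ ℝ^k, then v ≡ 0. -/
noncomputable section
open Real

/-- The Euclidean Laplacian on `ℝ^k`: sum of the pure second partial derivatives. -/
def lap {k : ℕ} (u : (Fin k → ℝ) → ℝ) (x : Fin k → ℝ) : ℝ :=
  ∑ i : Fin k, fderiv ℝ (fun y => fderiv ℝ u y (Pi.single i 1)) x (Pi.single i 1)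

theorem aux_second {g : ℝ → ℝ} (hg : ContinuousAt g 0) (hmax : IsLocalMax g 0) :
    deriv (deriv g) 0 ≤ 0 := by
  by_contra hlt
  push Not at hlt
  have hmin := isLocalMin_of_deriv_deriv_pos hlt hmax.deriv_eq_zero hg
  have hconst : g =ᶠ[nhds 0] fun _ => g 0 := by
    filter_upwards [hmin, hmax] with t h1 h2
    exact le_antisymm h2 h1
  have h1 := hconst.deriv.deriv_eq
  simp at h1
  linarith

theorem aux_lap {k : ℕ} (v : (Fin k → ℝ) → ℝ) (hv : ContDiff ℝ 2 v) (x : Fin k → ℝ)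
    (hx : ∀ y, v y ≤ v x) : lap v x ≤ 0 := by
  unfold lap
  refine Finset.sum_nonpos fun i _ => ?_
  set e : Fin k → ℝ := Pi.single i 1
  have hline : ∀ t : ℝ, HasDerivAt (fun t : ℝ => x + t • e) e t := fun t => by
    simpa using ((hasDerivAt_id t).smul_const e).const_add x
  have hd : Differentiable ℝ v := hv.differentiable (by norm_num)
  have h1 : deriv (fun t : ℝ => v (x + t • e)) = fun t => fderiv ℝ v (x + t • e) e := by
    funext t
    exact ((hd _).hasFDerivAt.comp_hasDerivAt t (hline t)).deriv
  have hd2 : Differentiable ℝ (fun y => fderiv ℝ v y e) := by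
    have : ContDiff ℝ 1 (fderiv ℝ v) := hv.fderiv_right (by norm_num)
    exact (this.differentiable (by norm_num)).clm_apply (differentiable_const e)
  have h2 : deriv (deriv (fun t : ℝ => v (x + t • e))) 0
      = fderiv ℝ (fun y => fderiv ℝ v y e) x e := by
    rw [h1]
    have := ((hd2 (x + (0:ℝ) • e)).hasFDerivAt.comp_hasDerivAt 0 (hline 0)).deriv
    simpa [Function.comp_def] using this
  rw [← h2]
  refine aux_second ?_ ?_
  · exact ((hd _).hasFDerivAt.comp_hasDerivAt 0 (hline 0)).continuousAt
  · refine Filter.Eventually.of_forall fun t => ?_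
    simpa using hx (x + t • e)

theorem aux_nonpos {k : ℕ} (c : (Fin k → ℝ) → ℝ) (hc : ∀ x, 0 < c x)
    (v : (Fin k → ℝ) → ℝ) (hv : ContDiff ℝ 2 v)
    (hvper : ∀ (x : Fin k → ℝ) (m : Fin k → ℤ), v (x + fun i => (m i : ℝ)) = v x)
    (heq : ∀ x, -lap v x + c x * v x = 0) : ∀ x, v x ≤ 0 := by
  obtain ⟨x₀, -, hx₀⟩ := (isCompact_Icc (a := (0 : Fin k → ℝ)) (b := 1)).exists_isMaxOn
    ⟨0, by simp⟩ hv.continuous.continuousOn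
  have hmax : ∀ y, v y ≤ v x₀ := by
    intro y
    rw [← hvper y (fun i => -⌊y i⌋)]
    refine hx₀ ⟨fun i => ?_, fun i => ?_⟩
    · have := Int.floor_le (y i)
      simp; linarith
    · have := Int.lt_floor_add_one (y i)
      simp; linarith
  have hl := aux_lap v hv x₀ hmax
  have he := heq x₀
  intro x
  refine (hmax x).trans ?_
  by_contra hpos
  push Not at hpos
  have := mul_pos (hc x₀) hpos
  linarith

theorem statement15 (k : ℕ) (hk : 1 ≤ k) (c : (Fin k → ℝ) → ℝ)
    (hcc : Continuous c)
    (hcper : ∀ (x : Fin k → ℝ) (m : Fin k → ℤ), c (x + fun i => (m i : ℝ)) = c x)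
    (hc : 0 < ⨅ x : Fin k → ℝ, c x)
    (v : (Fin k → ℝ) → ℝ) (hv : ContDiff ℝ 2 v)
    (hvper : ∀ (x : Fin k → ℝ) (m : Fin k → ℤ), v (x + fun i => (m i : ℝ)) = v x)
    (heq : ∀ x, -lap v x + c x * v x = 0) :
    ∀ x, v x = 0 := by
  have hpos : ∀ x, 0 < c x := by
    intro x
    by_cases hb : BddBelow (Set.range c)
    · exact hc.trans_le (ciInf_le hb x)
    · rw [Real.iInf_of_not_bddBelow hb] at hc
      exact absurd hc (lt_irrefl _)
  have hlapneg : ∀ x, lap (fun y => -v y) x = -lap v x := by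
    intro x
    simp [lap]
  intro x
  refine le_antisymm (aux_nonpos c hpos v hv hvper heq x) ?_
  have := aux_nonpos c hpos (fun y => -v y) hv.neg (fun x m => by simp [hvper])
    (fun x => by rw [hlapneg]; linarith [heq x]) x
  linarith
end
end

section
/- Let k ≥ 1 be an integer and let α, β : ℝ^k → ℝ be continuous ℤ^k-periodic functions with inf β > 0. If there exists a C², ℤ^k-periodic function u : ℝ^k → ℝ with u(x) > 0 for all x solving −Δu(x) + α(x) u(x) + β(x)/u(x) = 0 for all x ∈ ℝ^k, then there exists a point ξ ∈ ℝ^k with α(ξ) < 0. -/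
noncomputable section
open Real

lemma second_nonpos {k : ℕ} (u : (Fin k → ℝ) → ℝ) (hu : ContDiff ℝ 2 u) (x e : Fin k → ℝ)
    (hmax : ∀ y, u y ≤ u x) : fderiv ℝ (fun y => fderiv ℝ u y e) x e ≤ 0 := by
  have hl : ∀ t : ℝ, HasDerivAt (fun t : ℝ => x + t • e) e t := by
    intro t
    simpa using ((hasDerivAt_id t).smul_const e).const_add x
  have hd : Differentiable ℝ u := hu.differentiable (by norm_num)
  have hd2 : Differentiable ℝ (fun y => fderiv ℝ u y e) :=
    ((hu.fderiv_right (m := 1) (by norm_num)).clm_apply contDiff_const).differentiable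
      (by norm_num)
  have h1 : deriv (fun t : ℝ => u (x + t • e)) = fun t => fderiv ℝ u (x + t • e) e := by
    funext t
    exact ((hd _).hasFDerivAt.comp_hasDerivAt t (hl t)).deriv
  have h2 : deriv (deriv (fun t : ℝ => u (x + t • e))) 0
      = fderiv ℝ (fun y => fderiv ℝ u y e) x e := by
    rw [h1]
    have := ((hd2 (x + (0 : ℝ) • e)).hasFDerivAt.comp_hasDerivAt (0 : ℝ) (hl 0)).deriv
    simpa [Function.comp_def] using this
  by_contra hc
  push Not at hc
  have hM : IsLocalMax (fun t : ℝ => u (x + t • e)) 0 :=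
    Filter.Eventually.of_forall fun t => by simpa using hmax (x + t • e)
  have hm : IsLocalMin (fun t : ℝ => u (x + t • e)) 0 := by
    apply isLocalMin_of_deriv_deriv_pos (h2 ▸ hc) hM.deriv_eq_zero
    exact (hd.continuous.comp (by fun_prop)).continuousAt
  have hE : (fun t : ℝ => u (x + t • e)) =ᶠ[nhds 0] fun _ => u x := by
    filter_upwards [hm] with t ht
    exact le_antisymm (hmax _) (by simpa using ht)
  have h3 := hE.deriv.deriv_eq
  rw [h2] at h3
  simp at h3
  linarith

theorem statement16 (k : ℕ) (hk : 1 ≤ k) (α β : (Fin k → ℝ) → ℝ)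
    (hαc : Continuous α) (hβc : Continuous β)
    (hαper : ∀ (x : Fin k → ℝ) (m : Fin k → ℤ), α (x + fun i => (m i : ℝ)) = α x)
    (hβper : ∀ (x : Fin k → ℝ) (m : Fin k → ℤ), β (x + fun i => (m i : ℝ)) = β x)
    (hβ : 0 < ⨅ x : Fin k → ℝ, β x)
    (u : (Fin k → ℝ) → ℝ) (hu : ContDiff ℝ 2 u)
    (huper : ∀ (x : Fin k → ℝ) (m : Fin k → ℤ), u (x + fun i => (m i : ℝ)) = u x)
    (hupos : ∀ x, 0 < u x)
    (heq : ∀ x, -lap u x + α x * u x + β x / u x = 0) :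
    ∃ ξ : Fin k → ℝ, α ξ < 0 := by
  obtain ⟨x, -, hx⟩ := (isCompact_Icc (a := (0 : Fin k → ℝ)) (b := 1)).exists_isMaxOn
    ⟨0, by simp⟩ hu.continuous.continuousOn
  have hmax : ∀ y, u y ≤ u x := by
    intro y
    rw [← huper y (fun i => -⌊y i⌋)]
    apply hx
    constructor
    · intro i
      have := Int.floor_le (y i)
      simp
      linarith
    · intro i
      have := Int.lt_floor_add_one (y i)
      simp
      linarith
  have hb : 0 < β x := by
    by_cases hB : BddBelow (Set.range β)
    · exact hβ.trans_le (ciInf_le hB x)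
    · rw [Real.iInf_of_not_bddBelow hB] at hβ
      exact absurd hβ (lt_irrefl _)
  have hlap : lap u x ≤ 0 := Finset.sum_nonpos fun i _ => second_nonpos u hu x _ hmax
  refine ⟨x, ?_⟩
  by_contra hc
  push Not at hc
  have h1 := mul_nonneg hc (hupos x).le
  have h2 := div_pos hb (hupos x)
  linarith [heq x]
end
end
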